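/- arXiv:1706.09808 — 4 statements merged into one kernel-verified Lean document; each statement's English description precedes it below -/
import Mathlib

section
/- Let E be an arbitrary subset of ℝⁿ and f : E → ℝ, G : E → ℝⁿ functions satisfying: (i) G is continuous and f(x) ≥ f(y) + ⟨G(y), x − y⟩ for all x, y ∈ E; (ii) for every sequence (x_k) in E with |G(x_k)| → +∞ one has (⟨G(x_k), x_k⟩ − f(x_k))/|G(x_k)| → +∞; (iii) for all sequences (x_k), (z_k) in E such that (x_k) and (G(z_k)) are bounded and f(x_k) − f(z_k) − ⟨G(z_k), x_k − z_k⟩ → 0, one has |G(x_k) − G(z_k)| → 0; (iv) span{G(x) − G(y) : x, y ∈ E} = ℝⁿ. Then there exists a convex function F : ℝⁿ → ℝ of class C¹ such that F = f on E, ∇F = G on E, and F is essentially coercive. -/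
open Filter Topology Set
open scoped RealInnerProductSpace

noncomputable section

/-- A real-valued function on a normed space is *essentially coercive* if there exists a
linear function `ℓ` such that `f x - ℓ x → +∞` as `‖x‖ → ∞`. -/
def EssentiallyCoercive {V : Type*} [NormedAddCommGroup V] [NormedSpace ℝ V]
    (f : V → ℝ) : Prop :=
  ∃ ℓ : V →ₗ[ℝ] ℝ, Tendsto (fun x => f x - ℓ x) (comap norm atTop) atTop


section ConvexEnvelope

variable {V : Type*} [NormedAddCommGroup V] [InnerProductSpace ℝ V]

/-- `p` is a (Fréchet) supergradient of `g` at `x`: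
`g (x + h) ≤ g x + ⟪p, h⟫ + o(‖h‖)` as `h → 0`. -/
def HasSupergradientAt (g : V → ℝ) (p x : V) : Prop :=
  ∀ ε > 0, ∀ᶠ h in 𝓝 (0 : V), g (x + h) ≤ g x + ⟪p, h⟫ + ε * ‖h‖

/-- The convex envelope of `g`: the lower boundary of the convex hull of its graph. -/
def convexEnvelope (g : V → ℝ) (x : V) : ℝ :=
  sInf {t | (x, t) ∈ convexHull ℝ (range fun y => (y, g y))}

lemma ConvexOn.le_of_mem_convexHull_graph {g m : V → ℝ} (hm : ConvexOn ℝ univ m)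
    (hmg : ∀ x, m x ≤ g x) {x : V} {t : ℝ}
    (ht : (x, t) ∈ convexHull ℝ (range fun y => (y, g y))) : m x ≤ t := by
  have := convexHull_min (s := range fun y => (y, g y))
    (t := {p : V × ℝ | p.1 ∈ univ ∧ m p.1 ≤ p.2})
    (by rintro _ ⟨y, rfl⟩; exact ⟨mem_univ _, hmg y⟩) hm.convex_epigraph ht
  exact this.2

lemma mem_convexHull_graph (g : V → ℝ) (x : V) :
    (x, g x) ∈ convexHull ℝ (range fun y => (y, g y)) :=
  subset_convexHull ℝ _ ⟨x, rfl⟩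

lemma ConvexOn.le_convexEnvelope {g m : V → ℝ} (hm : ConvexOn ℝ univ m)
    (hmg : ∀ x, m x ≤ g x) (x : V) : m x ≤ convexEnvelope g x :=
  le_csInf ⟨g x, mem_convexHull_graph g x⟩ fun _ ht => hm.le_of_mem_convexHull_graph hmg ht

lemma convexEnvelope_le_of_mem {g : V → ℝ} {C : ℝ} (hg : ∀ x, C ≤ g x) {x : V} {t : ℝ}
    (ht : (x, t) ∈ convexHull ℝ (range fun y => (y, g y))) : convexEnvelope g x ≤ t :=
  csInf_le ⟨C, fun _ hs => (convexOn_const C convex_univ).le_of_mem_convexHull_graph hg hs⟩ ht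

lemma exists_mem_convexHull_graph_lt (g : V → ℝ) (x : V) {ε : ℝ} (hε : 0 < ε) :
    ∃ t, (x, t) ∈ convexHull ℝ (range fun y => (y, g y)) ∧ t < convexEnvelope g x + ε :=
  Real.lt_sInf_add_pos ⟨g x, mem_convexHull_graph g x⟩ hε

lemma convexOn_convexEnvelope {g : V → ℝ} {C : ℝ} (hg : ∀ x, C ≤ g x) :
    ConvexOn ℝ univ (convexEnvelope g) := by
  refine ⟨convex_univ, fun x _ y _ a b ha hb hab => le_of_forall_pos_le_add fun ε hε => ?_⟩
  obtain ⟨s, hs, hs'⟩ := exists_mem_convexHull_graph_lt g x hε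
  obtain ⟨t, ht, ht'⟩ := exists_mem_convexHull_graph_lt g y hε
  have h := convexEnvelope_le_of_mem hg (convex_convexHull ℝ _ hs ht ha hb hab)
  simp only [Prod.smul_mk, smul_eq_mul] at h ⊢
  calc _ ≤ _ := h
    _ ≤ a * (convexEnvelope g x + ε) + b * (convexEnvelope g y + ε) := by gcongr
    _ = _ := by linear_combination ε * hab

/-- By Carathéodory's theorem, a point in the convex hull of the graph of `g` has a component whose
weight is bounded below; that component can be moved freely. -/
lemma exists_component_of_mem_convexHull_graph [FiniteDimensional ℝ V] {g : V → ℝ} {C : ℝ}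
    (hg : ∀ x, -C ≤ g x) {x : V} {t : ℝ}
    (ht : (x, t) ∈ convexHull ℝ (range fun y => (y, g y))) :
    ∃ (w : ℝ) (y : V), w ∈ Icc ((Module.finrank ℝ (V × ℝ) + 1 : ℝ)⁻¹) 1 ∧
      g y + C ≤ (Module.finrank ℝ (V × ℝ) + 1) * (t + C) ∧
      ∀ h, (x + h, t + w * (g (y + w⁻¹ • h) - g y)) ∈
        convexHull ℝ (range fun y => (y, g y)) := by
  classical
  obtain ⟨ι, _, z, w, hz, hind, hw, hw1, hsum⟩ := eq_pos_convex_span_of_mem_convexHull ht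
  set N : ℝ := Module.finrank ℝ (V × ℝ) + 1 with hN
  have hNpos : 0 < N := by positivity
  have hcard : (Fintype.card ι : ℝ) ≤ N := by
    have := hind.card_le_finrank_succ
    have h2 := Submodule.finrank_le (vectorSpan ℝ (range z))
    rw [hN]; exact_mod_cast this.trans (by lia)
  have hzg : ∀ i, (z i).2 = g (z i).1 := by
    intro i
    obtain ⟨y, hy⟩ := hz ⟨i, rfl⟩
    rw [← hy]
  obtain ⟨i, hi⟩ : ∃ i, N⁻¹ ≤ w i := by
    by_contra! hcon
    have hne : (Finset.univ : Finset ι).Nonempty := by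
      by_contra hne
      rw [Finset.not_nonempty_iff_eq_empty] at hne
      simp [hne] at hw1
    have : ∑ i, w i < ∑ _i : ι, N⁻¹ := Finset.sum_lt_sum_of_nonempty hne fun i _ => hcon i
    rw [hw1, Finset.sum_const, nsmul_eq_mul, Finset.card_univ, ← div_eq_mul_inv,
      lt_div_iff₀ hNpos] at this
    linarith
  have hx : ∑ j, w j • (z j).1 = x := by
    have := congrArg Prod.fst hsum
    simpa [Prod.fst_sum] using this
  have ht' : ∑ j, w j * g (z j).1 = t := by
    have := congrArg Prod.snd hsum
    simpa [Prod.snd_sum, hzg] using this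
  have hile : w i ≤ 1 := hw1 ▸ Finset.single_le_sum (fun j _ => (hw j).le) (Finset.mem_univ i)
  refine ⟨w i, (z i).1, ⟨hi, hile⟩, ?_, fun h => ?_⟩
  · have h1 : w i * (g (z i).1 + C) ≤ ∑ j, w j * (g (z j).1 + C) :=
      Finset.single_le_sum (f := fun j => w j * (g (z j).1 + C))
        (fun j _ => mul_nonneg (hw j).le (by linarith [hg (z j).1])) (Finset.mem_univ i)
    have h2 : ∑ j, w j * (g (z j).1 + C) = t + C := by
      simp only [mul_add, Finset.sum_add_distrib, ht', ← Finset.sum_mul, hw1, one_mul]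
    have h3 : N⁻¹ * (g (z i).1 + C) ≤ t + C :=
      (mul_le_mul_of_nonneg_right hi (by linarith [hg (z i).1])).trans (h1.trans h2.le)
    rwa [inv_mul_le_iff₀ hNpos] at h3
  · have hwi : w i ≠ 0 := (hw i).ne'
    set v : V := (z i).1 + (w i)⁻¹ • h
    have key : ∑ j, w j • (Function.update z i (v, g v)) j
        = (x + h, t + w i * (g v - g (z i).1)) := by
      have h0 : ∀ j, w j • (Function.update z i (v, g v)) j
          = w j • z j + if j = i then (h, w i * (g v - g (z i).1)) else 0 := by
        intro j
        by_cases hj : j = i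
        · subst hj
          ext
          · simp [v, smul_add, smul_smul, hwi]
          · simp [hzg]; ring
        · simp [hj]
      rw [Finset.sum_congr rfl fun j _ => h0 j, Finset.sum_add_distrib, hsum]
      simp
    rw [← key]
    refine (convex_convexHull ℝ _).sum_mem (fun j _ => (hw j).le) hw1 fun j _ => ?_
    by_cases hj : j = i
    · subst hj; simpa using mem_convexHull_graph g v
    · simpa [hj] using subset_convexHull ℝ _ (hz ⟨j, rfl⟩)

lemma exists_convexEnvelope_add_le [FiniteDimensional ℝ V] {g : V → ℝ} {c C : ℝ} (hc : 0 < c)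
    (hgc : Continuous g) (hg : ∀ x, c * ‖x‖ - C ≤ g x) (x : V) :
    ∃ (w : ℝ) (y : V), 0 < w ∧
      ∀ h, convexEnvelope g (x + h) ≤ convexEnvelope g x + w * (g (y + w⁻¹ • h) - g y) := by
  have hg' : ∀ x, -C ≤ g x := fun x => by
    have := hg x
    have : 0 ≤ c * ‖x‖ := by positivity
    linarith
  set N : ℝ := Module.finrank ℝ (V × ℝ) + 1 with hN
  have hNpos : 0 < N := by positivity
  set F := convexEnvelope g
  have hex : ∀ k : ℕ, ∃ q : ℝ × V,
      q ∈ Icc N⁻¹ 1 ×ˢ Metric.closedBall (0 : V) (c⁻¹ * (N * (F x + 1 + C))) ∧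
      ∀ h, F (x + h) ≤ F x + 1 / ((k : ℝ) + 1) + q.1 * (g (q.2 + q.1⁻¹ • h) - g q.2) := by
    intro k
    have hk : 0 < 1 / ((k : ℝ) + 1) := Nat.one_div_pos_of_nat
    have hk1 : 1 / ((k : ℝ) + 1) ≤ 1 := by
      rw [div_le_one (by positivity)]; linarith [Nat.cast_nonneg (α := ℝ) k]
    obtain ⟨t, ht, htlt⟩ := exists_mem_convexHull_graph_lt g x hk
    obtain ⟨w, y, hw, hy, hyh⟩ := exists_component_of_mem_convexHull_graph hg' ht
    refine ⟨(w, y), ⟨hw, ?_⟩, fun h => ?_⟩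
    · rw [mem_closedBall_zero_iff, ← div_eq_inv_mul, le_div_iff₀' hc]
      have h1 := hg y
      have h2 : N * (t + C) ≤ N * (F x + 1 + C) := by gcongr; linarith
      linarith
    · have := convexEnvelope_le_of_mem hg' (hyh h)
      simp only
      linarith
  choose q hq hqF using hex
  obtain ⟨⟨w, y⟩, hwy, φ, hφ, hlim⟩ :=
    (isCompact_Icc.prod (isCompact_closedBall (0 : V) _)).tendsto_subseq hq
  have hwpos : 0 < w := lt_of_lt_of_le (by positivity) hwy.1.1
  refine ⟨w, y, hwpos, fun h => ?_⟩
  have h1 : Tendsto (fun k => (q (φ k)).1) atTop (𝓝 w) := (continuous_fst.tendsto _).comp hlim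
  have h2 : Tendsto (fun k => (q (φ k)).2) atTop (𝓝 y) := (continuous_snd.tendsto _).comp hlim
  have h3 : Tendsto (fun k : ℕ => 1 / ((φ k : ℝ) + 1)) atTop (𝓝 0) :=
    tendsto_one_div_add_atTop_nhds_zero_nat.comp hφ.tendsto_atTop
  have h4 : Tendsto (fun k => g ((q (φ k)).2 + (q (φ k)).1⁻¹ • h)) atTop (𝓝 (g (y + w⁻¹ • h))) :=
    (hgc.tendsto _).comp (h2.add ((h1.inv₀ hwpos.ne').smul_const h))
  have h5 := (hgc.tendsto _).comp h2
  have h6 := (h3.const_add (F x)).add (h1.mul (h4.sub h5))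
  rw [add_zero] at h6
  exact ge_of_tendsto' h6 fun k => hqF (φ k) h

lemma exists_hasSupergradientAt_convexEnvelope [FiniteDimensional ℝ V] {g : V → ℝ} {c C : ℝ}
    (hc : 0 < c) (hgc : Continuous g) (hg : ∀ x, c * ‖x‖ - C ≤ g x)
    (hsup : ∀ y, ∃ p, HasSupergradientAt g p y) (x : V) :
    ∃ p, HasSupergradientAt (convexEnvelope g) p x := by
  obtain ⟨w, y, hw, hF⟩ := exists_convexEnvelope_add_le hc hgc hg x
  obtain ⟨p, hp⟩ := hsup y
  refine ⟨p, fun ε hε => ?_⟩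
  have ht : Tendsto (fun h : V => w⁻¹ • h) (𝓝 0) (𝓝 0) := by
    simpa using (continuous_const_smul w⁻¹ : Continuous fun h : V => w⁻¹ • h).tendsto 0
  filter_upwards [ht.eventually (hp ε hε)] with h hh
  refine (hF h).trans ?_
  rw [inner_smul_right, norm_smul, Real.norm_of_nonneg (by positivity)] at hh
  have h1 : w * (g (y + w⁻¹ • h) - g y) ≤ w * (w⁻¹ * ⟪p, h⟫ + ε * (w⁻¹ * ‖h‖)) := by
    gcongr; linarith
  have h2 : w * (w⁻¹ * ⟪p, h⟫ + ε * (w⁻¹ * ‖h‖)) = ⟪p, h⟫ + ε * ‖h‖ := by field_simp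
  linarith

lemma HasSupergradientAt.hasGradientAt [CompleteSpace V] {F : V → ℝ} {p x : V}
    (hp : HasSupergradientAt F p x) (hF : ConvexOn ℝ univ F) : HasGradientAt F p x := by
  rw [hasGradientAt_iff_hasFDerivAt, hasFDerivAt_iff_isLittleO_nhds_zero, Asymptotics.isLittleO_iff]
  intro ε hε
  have hneg : Tendsto (fun h : V => -h) (𝓝 0) (𝓝 0) := by
    simpa using (continuous_neg : Continuous fun h : V => -h).tendsto 0
  filter_upwards [hp ε hε, hneg.eventually (hp ε hε)] with h h1 h2
  have h3 := hF.2 (mem_univ (x + h)) (mem_univ (x + -h))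
    (one_half_pos (α := ℝ)).le (one_half_pos (α := ℝ)).le (add_halves 1)
  have h4 : (1 / 2 : ℝ) • (x + h) + (1 / 2 : ℝ) • (x + -h) = x := by module
  rw [h4] at h3
  simp only [smul_eq_mul, inner_neg_right, norm_neg] at h2 h3
  rw [InnerProductSpace.toDual_apply_apply, Real.norm_eq_abs, abs_le]
  constructor <;> linarith

lemma ConvexOn.add_inner_le_of_hasGradientAt [CompleteSpace V] {F : V → ℝ} {p x : V}
    (hF : ConvexOn ℝ univ F) (hp : HasGradientAt F p x) (h : V) :
    F x + ⟪p, h⟫ ≤ F (x + h) := by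
  have hd : HasDerivAt (fun t : ℝ => F (x + t • h)) ⟪p, h⟫ 0 := by
    have h1 : HasDerivAt (fun t : ℝ => x + t • h) h 0 := by
      simpa using ((hasDerivAt_id (0 : ℝ)).smul_const h).const_add x
    have h2 : HasFDerivAt F (InnerProductSpace.toDual ℝ V p) (x + (0 : ℝ) • h) := by
      simpa using hp.hasFDerivAt
    have h3 := h2.comp_hasDerivAt (0 : ℝ) h1
    rwa [InnerProductSpace.toDual_apply_apply] at h3
  have hconv : ConvexOn ℝ univ (fun t : ℝ => F (x + t • h)) := by
    refine ⟨convex_univ, fun s _ t _ a b ha hb hab => ?_⟩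
    have := hF.2 (mem_univ (x + s • h)) (mem_univ (x + t • h)) ha hb hab
    convert this using 2
    have : x = (a + b) • x := by rw [hab, one_smul]
    nth_rw 1 [this]
    simp only [smul_eq_mul]; module
  have := hconv.le_slope_of_hasDerivAt (mem_univ 0) (mem_univ 1) one_pos hd
  simp [slope_def_field] at this
  linarith

lemma ConvexOn.contDiff_one_of_hasGradientAt [CompleteSpace V] {F : V → ℝ} {p : V → V}
    (hF : ConvexOn ℝ univ F) (hp : ∀ x, HasGradientAt F (p x) x) : ContDiff ℝ 1 F := by
  have hdiff : Differentiable ℝ F := fun x => (hp x).differentiableAt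
  have hcont : Continuous p := by
    rw [continuous_iff_continuousAt]
    intro x
    rw [Metric.continuousAt_iff']
    intro ε hε
    have h1 := (hp x).hasFDerivAt
    rw [hasFDerivAt_iff_isLittleO_nhds_zero, Asymptotics.isLittleO_iff] at h1
    obtain ⟨δ, hδ, hball⟩ := Metric.eventually_nhds_iff.1 (h1 (c := ε / 8) (by positivity))
    set r := δ / 2
    have hr : 0 < r := by positivity
    have e1 : ∀ᶠ y in 𝓝 x, ‖y - x‖ < r / 2 := by
      have : Tendsto (fun y => ‖y - x‖) (𝓝 x) (𝓝 0) := by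
        simpa using ((continuous_id.sub continuous_const).norm :
          Continuous fun y => ‖y - x‖).tendsto x
      exact this.eventually_lt_const (by positivity)
    have e2 : ∀ᶠ y in 𝓝 x, F x - F y + ‖p x‖ * ‖y - x‖ < ε * r / 8 := by
      have : Tendsto (fun y => F x - F y + ‖p x‖ * ‖y - x‖) (𝓝 x) (𝓝 0) := by
        have : Continuous fun y => F x - F y + ‖p x‖ * ‖y - x‖ := by
          have := hdiff.continuous
          fun_prop
        simpa using this.tendsto x
      exact this.eventually_lt_const (by positivity)
    filter_upwards [e1, e2] with y hy1 hy2
    rw [dist_eq_norm]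
    by_cases hne : p y - p x = 0
    · rw [hne, norm_zero]; exact hε
    have hnpos : 0 < ‖p y - p x‖ := norm_pos_iff.2 hne
    set h : V := (r / ‖p y - p x‖) • (p y - p x) with hh
    have hnorm : ‖h‖ = r := by
      rw [hh, norm_smul, Real.norm_of_nonneg (by positivity)]; field_simp
    have hinner : ⟪p y, h⟫ - ⟪p x, h⟫ = r * ‖p y - p x‖ := by
      rw [← inner_sub_left, hh, inner_smul_right, real_inner_self_eq_norm_sq]; field_simp
    have h2 := hball (y := h) (by rw [dist_zero_right, hnorm]; simp only [r]; linarith)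
    rw [InnerProductSpace.toDual_apply_apply, Real.norm_eq_abs, abs_le, hnorm] at h2
    have h3 := hF.add_inner_le_of_hasGradientAt (hp y) (x + h - y)
    have h4 : ⟪p y, x + h - y⟫ = ⟪p y, h⟫ - ⟪p y, y - x⟫ := by
      rw [← inner_sub_right]; congr 1; abel
    rw [h4, add_sub_cancel] at h3
    have h5 : ⟪p y, y - x⟫ ≤ (‖p y - p x‖ + ‖p x‖) * ‖y - x‖ := by
      refine (real_inner_le_norm _ _).trans ?_
      gcongr
      simpa using norm_add_le (p y - p x) (p x)
    have h6 : ‖p y - p x‖ * ‖y - x‖ ≤ ‖p y - p x‖ * (r / 2) := by gcongr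
    have h7 : r * ‖p y - p x‖ < r * ε := by nlinarith
    exact lt_of_mul_lt_mul_left h7 hr.le
  rw [contDiff_one_iff_fderiv]
  refine ⟨hdiff, ?_⟩
  have : fderiv ℝ F = fun x => InnerProductSpace.toDual ℝ V (p x) :=
    funext fun x => (hp x).hasFDerivAt.fderiv
  rw [this]
  exact (InnerProductSpace.toDual ℝ V).continuous.comp hcont

end ConvexEnvelope

section SmoothMajorant

open scoped Manifold ContDiff

variable {V : Type*} [NormedAddCommGroup V] [InnerProductSpace ℝ V] [FiniteDimensional ℝ V]

lemma Continuous.exists_majorant_differentiableAt {m ε : V → ℝ} (hm : Continuous m)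
    (hε : Continuous ε) (hε0 : ∀ x, 0 ≤ ε x) :
    ∃ g : V → ℝ, Continuous g ∧ (∀ x, m x ≤ g x) ∧ (∀ x, g x ≤ m x + ε x) ∧
      ∀ x, 0 < ε x → DifferentiableAt ℝ g x := by
  classical
  let U : TopologicalSpace.Opens V := ⟨{x | 0 < ε x}, isOpen_lt continuous_const hε⟩
  have : SigmaCompactSpace U := by
    have : LocallyCompactSpace U := U.isOpen.locallyCompactSpace
    exact sigmaCompactSpace_of_locallyCompact_secondCountable
  have hfc : Continuous fun x : U => m x + ε x / 2 := by fun_prop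
  have hec : Continuous fun x : U => ε x / 2 := by fun_prop
  obtain ⟨g₀, hg₀, -⟩ := hfc.exists_contMDiff_approx 𝓘(ℝ, V) 1 hec fun x => half_pos x.2
  let g : V → ℝ := fun x => if hx : x ∈ U then g₀ ⟨x, hx⟩ else m x
  have hgU : ∀ x : U, g x = g₀ x := fun x => dif_pos x.2
  have hbound : ∀ x, m x ≤ g x ∧ g x ≤ m x + ε x := by
    intro x
    by_cases hx : x ∈ U
    · have := hg₀ ⟨x, hx⟩
      rw [← hgU ⟨x, hx⟩, Real.dist_eq, abs_lt] at this
      constructor <;> linarith [this.1, this.2]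
    · simp only [g, dif_neg hx]
      exact ⟨le_rfl, by linarith [hε0 x]⟩
  have hdiff : ∀ x, 0 < ε x → DifferentiableAt ℝ g x := by
    intro x hx
    have h1 : ContMDiffAt 𝓘(ℝ, V) 𝓘(ℝ, ℝ) 1 (fun y : U => g y) ⟨x, hx⟩ := by
      rw [show (fun y : U => g y) = g₀ from funext hgU]
      exact g₀.contMDiff.contMDiffAt
    rw [contMDiffAt_subtype_iff] at h1
    exact h1.contDiffAt.differentiableAt (by simp)
  refine ⟨g, continuous_iff_continuousAt.2 fun x => ?_, fun x => (hbound x).1,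
    fun x => (hbound x).2, hdiff⟩
  by_cases hx : 0 < ε x
  · exact (hdiff x hx).continuousAt
  · have hx0 : ε x = 0 := le_antisymm (not_lt.1 hx) (hε0 x)
    have hgx : g x = m x := le_antisymm (by linarith [(hbound x).2]) (hbound x).1
    rw [ContinuousAt, hgx]
    refine tendsto_of_tendsto_of_tendsto_of_le_of_le (hm.tendsto x) ?_
      (fun y => (hbound y).1) (fun y => (hbound y).2)
    simpa [hx0] using (hm.tendsto x).add (hε.tendsto x)

end SmoothMajorant

section TangentEnvelope

variable {V : Type*} [NormedAddCommGroup V] [InnerProductSpace ℝ V]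

/-- The minimal convex extension of a convex 1-jet: the supremum of its tangent functions. -/
def tangentEnvelope (E : Set V) (f : V → ℝ) (G : V → V) (x : V) : ℝ :=
  ⨆ y : E, (f y + ⟪G y, x - y⟫)

variable {E : Set V} {f : V → ℝ} {G : V → V}

/-- The 1-jet satisfies `(⟪G y, y⟫ - f y) / ‖G y‖ → ∞` as `‖G y‖ → ∞`. -/
def SuperlinearJet (E : Set V) (f : V → ℝ) (G : V → V) : Prop :=
  ∀ C : ℝ, ∃ B : ℝ, ∀ y ∈ E, B ≤ ‖G y‖ → C * ‖G y‖ ≤ ⟪G y, y⟫ - f y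

lemma superlinearJet_of_seq
    (hEX : ∀ x : ℕ → V, (∀ k, x k ∈ E) → Tendsto (fun k => ‖G (x k)‖) atTop atTop →
      Tendsto (fun k => (⟪G (x k), x k⟫ - f (x k)) / ‖G (x k)‖) atTop atTop) :
    SuperlinearJet E f G := by
  intro C
  by_contra! hcon
  choose x hxE hxB hxC using fun k : ℕ => hcon (k + 1)
  have htop : Tendsto (fun k => ‖G (x k)‖) atTop atTop :=
    tendsto_atTop_mono (fun k => le_trans (by linarith) (hxB k)) tendsto_natCast_atTop_atTop
  obtain ⟨k, hk⟩ := ((hEX x hxE htop).eventually_ge_atTop C).exists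
  have hpos : 0 < ‖G (x k)‖ := lt_of_lt_of_le (by positivity) (hxB k)
  rw [le_div_iff₀ hpos] at hk
  exact (hxC k).not_ge hk

lemma SuperlinearJet.bddAbove (hEX : SuperlinearJet E f G)
    (hC : ∀ x ∈ E, ∀ y ∈ E, f x ≥ f y + ⟪G y, x - y⟫) (x : V) :
    BddAbove (range fun y : E => f y + ⟪G y, x - y⟫) := by
  obtain ⟨B, hB⟩ := hEX ‖x‖
  rcases E.eq_empty_or_nonempty with rfl | ⟨x₀, hx₀⟩
  · exact ⟨0, by rintro _ ⟨y, -⟩; exact y.2.elim⟩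
  refine ⟨max 0 (f x₀ + B * ‖x - x₀‖), ?_⟩
  rintro _ ⟨⟨y, hy⟩, rfl⟩
  simp only
  rcases le_total B ‖G y‖ with h | h
  · refine le_max_of_le_left ?_
    have h1 := hB y hy h
    have h2 := real_inner_le_norm (G y) x
    rw [inner_sub_right]
    linarith
  · refine le_max_of_le_right ?_
    have h1 := hC x₀ hx₀ y hy
    have h2 : ⟪G y, x - y⟫ = ⟪G y, x₀ - y⟫ + ⟪G y, x - x₀⟫ := by
      rw [← inner_add_right]; congr 1; abel
    have h3 : ⟪G y, x - x₀⟫ ≤ B * ‖x - x₀‖ :=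
      (real_inner_le_norm _ _).trans (by gcongr)
    linarith

lemma SuperlinearJet.le_tangentEnvelope (hEX : SuperlinearJet E f G)
    (hC : ∀ x ∈ E, ∀ y ∈ E, f x ≥ f y + ⟪G y, x - y⟫) (x : V) {y : V} (hy : y ∈ E) :
    f y + ⟪G y, x - y⟫ ≤ tangentEnvelope E f G x :=
  le_ciSup (hEX.bddAbove hC x) ⟨y, hy⟩

lemma SuperlinearJet.tangentEnvelope_eq (hEX : SuperlinearJet E f G)
    (hC : ∀ x ∈ E, ∀ y ∈ E, f x ≥ f y + ⟪G y, x - y⟫) {x : V} (hx : x ∈ E) :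
    tangentEnvelope E f G x = f x := by
  have : Nonempty E := ⟨⟨x, hx⟩⟩
  refine le_antisymm (ciSup_le fun y => hC x hx y y.2) ?_
  simpa using hEX.le_tangentEnvelope hC x hx

lemma SuperlinearJet.convexOn_tangentEnvelope (hEX : SuperlinearJet E f G)
    (hC : ∀ x ∈ E, ∀ y ∈ E, f x ≥ f y + ⟪G y, x - y⟫) (hE : E.Nonempty) :
    ConvexOn ℝ univ (tangentEnvelope E f G) := by
  have := hE.to_subtype
  refine ⟨convex_univ, fun x _ z _ a b ha hb hab => ciSup_le fun y => ?_⟩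
  have h1 : a • x + b • z - (y : V) = a • (x - y) + b • (z - y) := by
    have : (y : V) = (a + b) • (y : V) := by rw [hab, one_smul]
    nth_rw 1 [this]; module
  have h2 := mul_le_mul_of_nonneg_left (hEX.le_tangentEnvelope hC x y.2) ha
  have h3 := mul_le_mul_of_nonneg_left (hEX.le_tangentEnvelope hC z y.2) hb
  rw [h1, inner_add_right, inner_smul_right, inner_smul_right, smul_eq_mul, smul_eq_mul]
  calc _ = a * (f y + ⟪G y, x - y⟫) + b * (f y + ⟪G y, z - y⟫) := by
        linear_combination (-f y) * hab
    _ ≤ _ := add_le_add h2 h3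

/-- Slopes of tangent functions with values bounded below near a point are bounded. -/
lemma SuperlinearJet.exists_norm_le (hEX : SuperlinearJet E f G) (R A : ℝ) :
    ∃ M, ∀ x, ‖x‖ ≤ R → ∀ y ∈ E, A ≤ f y + ⟪G y, x - y⟫ → ‖G y‖ ≤ M := by
  obtain ⟨B, hB⟩ := hEX (R + 1)
  refine ⟨max B (-A), fun x hx y hy hA => ?_⟩
  rcases le_total ‖G y‖ B with h | h
  · exact le_max_of_le_left h
  · refine le_max_of_le_right ?_
    have h1 := hB y hy h
    have h2 : ⟪G y, x⟫ ≤ ‖G y‖ * R := (real_inner_le_norm _ _).trans (by gcongr)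
    rw [inner_sub_right] at hA
    linarith

variable [FiniteDimensional ℝ V]

lemma SuperlinearJet.continuous_tangentEnvelope (hEX : SuperlinearJet E f G)
    (hC : ∀ x ∈ E, ∀ y ∈ E, f x ≥ f y + ⟪G y, x - y⟫) (hE : E.Nonempty) :
    Continuous (tangentEnvelope E f G) :=
  (hEX.convexOn_tangentEnvelope hC hE).locallyLipschitz.continuous

/-- At a point of the closure of `E`, the slopes of almost active tangent functions converge. -/
lemma SuperlinearJet.exists_tendsto_slope (hEX : SuperlinearJet E f G)
    (hC : ∀ x ∈ E, ∀ y ∈ E, f x ≥ f y + ⟪G y, x - y⟫)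
    (hCW : ∀ x z : ℕ → V, (∀ k, x k ∈ E) → (∀ k, z k ∈ E) →
      (∃ M, ∀ k, ‖x k‖ ≤ M) → (∃ M, ∀ k, ‖G (z k)‖ ≤ M) →
      Tendsto (fun k => f (x k) - f (z k) - ⟪G (z k), x k - z k⟫) atTop (𝓝 0) →
      Tendsto (fun k => ‖G (x k) - G (z k)‖) atTop (𝓝 0))
    {x₀ : V} (hx₀ : x₀ ∈ closure E) :
    ∃ p, ∀ y : ℕ → V, (∀ k, y k ∈ E) →
      Tendsto (fun k => f (y k) + ⟪G (y k), x₀ - y k⟫) atTop (𝓝 (tangentEnvelope E f G x₀)) →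
      Tendsto (fun k => G (y k)) atTop (𝓝 p) := by
  have hE : E.Nonempty := closure_nonempty_iff.1 ⟨x₀, hx₀⟩
  have := hE.to_subtype
  set m := tangentEnvelope E f G
  have hmc : Continuous m := hEX.continuous_tangentEnvelope hC hE
  obtain ⟨x, hxE, hx⟩ := mem_closure_iff_seq_limit.1 hx₀
  have hxb : ∃ M, ∀ k, ‖x k‖ ≤ M := by
    obtain ⟨M, hM⟩ := (Metric.isBounded_range_of_tendsto x hx).exists_norm_le
    exact ⟨M, fun k => hM _ ⟨k, rfl⟩⟩
  have hbdd : ∀ y : ℕ → V, (∀ k, y k ∈ E) →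
      Tendsto (fun k => f (y k) + ⟪G (y k), x₀ - y k⟫) atTop (𝓝 (m x₀)) →
      ∃ M, ∀ k, ‖G (y k)‖ ≤ M := by
    intro y hy hlim
    obtain ⟨A, hA⟩ := hlim.bddBelow_range
    obtain ⟨M, hM⟩ := hEX.exists_norm_le ‖x₀‖ A
    exact ⟨M, fun k => hM x₀ le_rfl (y k) (hy k) (hA ⟨k, rfl⟩)⟩
  have hcomp : ∀ y : ℕ → V, (∀ k, y k ∈ E) →
      Tendsto (fun k => f (y k) + ⟪G (y k), x₀ - y k⟫) atTop (𝓝 (m x₀)) →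
      Tendsto (fun k => G (x k) - G (y k)) atTop (𝓝 0) := by
    intro y hy hlim
    obtain ⟨M, hM⟩ := hbdd y hy hlim
    refine tendsto_zero_iff_norm_tendsto_zero.2 (hCW x y hxE hy hxb ⟨M, hM⟩ ?_)
    have h1 : Tendsto (fun k => m (x k)) atTop (𝓝 (m x₀)) := (hmc.tendsto x₀).comp hx
    have h2 : Tendsto (fun k => ⟪G (y k), x k - x₀⟫) atTop (𝓝 0) := by
      have h3 : Tendsto (fun k => M * ‖x k - x₀‖) atTop (𝓝 0) := by
        simpa using (tendsto_iff_norm_sub_tendsto_zero.1 hx).const_mul M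
      refine squeeze_zero_norm (fun k => (norm_inner_le_norm _ _).trans ?_) h3
      gcongr
      exact hM k
    have h4 := (h1.sub hlim).sub h2
    rw [sub_self, sub_zero] at h4
    refine h4.congr fun k => ?_
    have h5 : ⟪G (y k), x k - y k⟫ = ⟪G (y k), x k - x₀⟫ + ⟪G (y k), x₀ - y k⟫ := by
      rw [← inner_add_right]; congr 1; abel
    have h6 : m (x k) = f (x k) := hEX.tangentEnvelope_eq hC (hxE k)
    rw [h5, h6]
    ring
  obtain ⟨u, -, hulim, hu⟩ := exists_seq_tendsto_sSup
    (S := range fun y : E => f y + ⟪G y, x₀ - y⟫) (range_nonempty _) (hEX.bddAbove hC x₀)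
  choose y hy using hu
  have hylim : Tendsto (fun k => f (y k) + ⟪G (y k), x₀ - y k⟫) atTop (𝓝 (m x₀)) := by
    simpa only [hy] using! hulim
  obtain ⟨M, hM⟩ := hbdd (fun k => y k) (fun k => (y k).2) hylim
  obtain ⟨p, -, φ, hφ, hp⟩ := tendsto_subseq_of_bounded (x := fun k => G (y k))
    (Metric.isBounded_closedBall (x := (0 : V)) (r := M)) fun k => by simpa using hM k
  have hxp : Tendsto (fun k => G (x k)) atTop (𝓝 p) := by
    have := (hcomp (fun k => y (φ k)) (fun k => (y (φ k)).2)
      (hylim.comp hφ.tendsto_atTop)).add hp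
    simpa using this
  refine ⟨p, fun z hz hzlim => ?_⟩
  simpa using hxp.sub (hcomp z hz hzlim)

lemma SuperlinearJet.exists_hasSupergradientAt_tangentEnvelope (hEX : SuperlinearJet E f G)
    (hC : ∀ x ∈ E, ∀ y ∈ E, f x ≥ f y + ⟪G y, x - y⟫)
    (hCW : ∀ x z : ℕ → V, (∀ k, x k ∈ E) → (∀ k, z k ∈ E) →
      (∃ M, ∀ k, ‖x k‖ ≤ M) → (∃ M, ∀ k, ‖G (z k)‖ ≤ M) →
      Tendsto (fun k => f (x k) - f (z k) - ⟪G (z k), x k - z k⟫) atTop (𝓝 0) →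
      Tendsto (fun k => ‖G (x k) - G (z k)‖) atTop (𝓝 0))
    {x₀ : V} (hx₀ : x₀ ∈ closure E) :
    ∃ p, HasSupergradientAt (tangentEnvelope E f G) p x₀ := by
  have hE : E.Nonempty := closure_nonempty_iff.1 ⟨x₀, hx₀⟩
  have := hE.to_subtype
  obtain ⟨p, hp⟩ := hEX.exists_tendsto_slope hC hCW hx₀
  set m := tangentEnvelope E f G with hm
  have hmc : Continuous m := hEX.continuous_tangentEnvelope hC hE
  refine ⟨p, fun ε hε => ?_⟩
  by_contra hcon
  rw [not_eventually] at hcon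
  obtain ⟨h, hh, hlt⟩ := exists_seq_forall_of_frequently hcon
  simp only [not_le] at hlt
  have hy : ∀ k, ∃ y ∈ E, m (x₀ + h k) - ε / 2 * ‖h k‖ ≤ f y + ⟪G y, x₀ + h k - y⟫ := by
    intro k
    by_cases h0 : h k = 0
    · have := hlt k
      simp [h0] at this
    · obtain ⟨y, hy⟩ := exists_lt_of_lt_ciSup (f := fun y : E => f y + ⟪G y, x₀ + h k - y⟫)
        (show m (x₀ + h k) - ε / 2 * ‖h k‖ < _ from sub_lt_self _ (by positivity))
      exact ⟨y, y.2, hy.le⟩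
  choose y hyE hy using hy
  have hxh : Tendsto (fun k => x₀ + h k) atTop (𝓝 x₀) := by simpa using hh.const_add x₀
  have hlow : Tendsto (fun k => m (x₀ + h k) - ε / 2 * ‖h k‖) atTop (𝓝 (m x₀)) := by
    have := ((hmc.tendsto x₀).comp hxh).sub (hh.norm.const_mul (ε / 2))
    simpa using this
  obtain ⟨A, hA⟩ := hlow.bddBelow_range
  obtain ⟨R, hR⟩ := (Metric.isBounded_range_of_tendsto _ hxh).exists_norm_le
  obtain ⟨M, hM⟩ := hEX.exists_norm_le R A
  have hGb : ∀ k, ‖G (y k)‖ ≤ M := fun k =>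
    hM _ (hR _ ⟨k, rfl⟩) _ (hyE k) ((hA ⟨k, rfl⟩).trans (hy k))
  have hsplit : ∀ k, ⟪G (y k), x₀ + h k - y k⟫ = ⟪G (y k), x₀ - y k⟫ + ⟪G (y k), h k⟫ := by
    intro k
    rw [← inner_add_right]; congr 1; abel
  have hin : Tendsto (fun k => ⟪G (y k), h k⟫) atTop (𝓝 0) := by
    have h3 : Tendsto (fun k => M * ‖h k‖) atTop (𝓝 0) := by simpa using hh.norm.const_mul M
    refine squeeze_zero_norm (fun k => (norm_inner_le_norm _ _).trans ?_) h3
    gcongr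
    exact hGb k
  have hmax : Tendsto (fun k => f (y k) + ⟪G (y k), x₀ - y k⟫) atTop (𝓝 (m x₀)) := by
    refine tendsto_of_tendsto_of_tendsto_of_le_of_le (by simpa using hlow.sub hin)
      tendsto_const_nhds (fun k => ?_) fun k => hEX.le_tangentEnvelope hC x₀ (hyE k)
    have := hy k
    rw [hsplit] at this
    simp only
    linarith
  have hGp := tendsto_iff_norm_sub_tendsto_zero.1 (hp y hyE hmax)
  obtain ⟨k, hk⟩ := (hGp.eventually_lt_const (half_pos hε)).exists
  have h1 := hlt k
  have h2 := hy k
  rw [hsplit] at h2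
  have h3 := hEX.le_tangentEnvelope hC x₀ (hyE k)
  have h4 : ⟪G (y k), h k⟫ - ⟪p, h k⟫ ≤ ε / 2 * ‖h k‖ := by
    rw [← inner_sub_left]
    exact (real_inner_le_norm _ _).trans (by gcongr)
  linarith

end TangentEnvelope

section Coercivity

variable {V : Type*} [NormedAddCommGroup V] [InnerProductSpace ℝ V] [FiniteDimensional ℝ V]
  {E : Set V} {f : V → ℝ} {G : V → V}

lemma exists_finset_separating_slopes (hE : E.Nonempty)
    (hspan : Submodule.span ℝ {w | ∃ x ∈ E, ∃ y ∈ E, w = G x - G y} = ⊤) :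
    ∃ T : Finset V, T.Nonempty ∧ ↑T ⊆ E ∧
      ∀ x, (∀ y ∈ T, ∀ z ∈ T, ⟪G y, x⟫ = ⟪G z, x⟫) → x = 0 := by
  classical
  obtain ⟨x₀, hx₀⟩ := hE
  obtain ⟨s, hsub, hs⟩ := (Submodule.fg_span_iff_fg_span_finset_subset
    {w | ∃ x ∈ E, ∃ y ∈ E, w = G x - G y}).1
    (by rw [hspan]; exact Module.finite_def.1 inferInstance)
  choose! u hu v hv huv using fun w (hw : w ∈ (s : Set V)) => hsub hw
  refine ⟨insert x₀ (s.image u ∪ s.image v), Finset.insert_nonempty _ _, ?_, fun x hx => ?_⟩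
  · intro y hy
    simp only [Finset.coe_insert, Finset.coe_union, Finset.coe_image, mem_insert_iff, mem_union,
      mem_image] at hy
    rcases hy with rfl | ⟨w, hw, rfl⟩ | ⟨w, hw, rfl⟩
    exacts [hx₀, hu w hw, hv w hw]
  · have hle : Submodule.span ℝ (s : Set V) ≤ (innerₛₗ ℝ x).ker := by
      refine Submodule.span_le.2 fun w hw => ?_
      have h1 := hx (u w) (Finset.mem_insert_of_mem
          (Finset.mem_union_left _ (Finset.mem_image_of_mem u hw)))
        (v w) (Finset.mem_insert_of_mem (Finset.mem_union_right _ (Finset.mem_image_of_mem v hw)))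
      change ⟪x, w⟫ = 0
      rw [huv w hw, inner_sub_right, real_inner_comm, h1, real_inner_comm, sub_self]
    rw [← hs, hspan] at hle
    exact inner_self_eq_zero.1 (hle (Submodule.mem_top (x := x)))

lemma exists_norm_le_of_forall_inner_le (T : Finset V) (hT : T.Nonempty) (v : V → V)
    (hsum : ∑ y ∈ T, v y = 0) (hsep : ∀ x, (∀ y ∈ T, ⟪v y, x⟫ = 0) → x = 0) :
    ∃ K > 0, ∀ (x : V) (B : ℝ), (∀ y ∈ T, ⟪v y, x⟫ ≤ B) → ‖x‖ ≤ K * B := by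
  let Φ : V →ₗ[ℝ] (T → ℝ) := LinearMap.pi fun y => innerₛₗ ℝ (v y)
  have hΦ : ∀ x y, Φ x y = ⟪v y, x⟫ := fun _ _ => rfl
  obtain ⟨K, hK, hlip⟩ := Φ.exists_antilipschitzWith (by
    rw [LinearMap.ker_eq_bot']
    exact fun x hx => hsep x fun y hy => by rw [← hΦ x ⟨y, hy⟩, hx]; rfl)
  have hcard : (1 : ℝ) ≤ T.card := by exact_mod_cast hT.card_pos
  refine ⟨K * T.card, by positivity, fun x B hB => ?_⟩
  have h1 : ∑ y ∈ T, (B - ⟪v y, x⟫) = T.card * B := by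
    rw [Finset.sum_sub_distrib, ← sum_inner, hsum, inner_zero_left, Finset.sum_const, nsmul_eq_mul,
      sub_zero]
  have h2 : ∀ y ∈ T, 0 ≤ B - ⟪v y, x⟫ := fun y hy => sub_nonneg.2 (hB y hy)
  have h3 : 0 ≤ T.card * B := h1 ▸ Finset.sum_nonneg h2
  have h4 : 0 ≤ B := nonneg_of_mul_nonneg_right h3 (by linarith)
  have h5 : ‖Φ x‖ ≤ T.card * B := by
    refine (pi_norm_le_iff_of_nonneg h3).2 fun y => ?_
    rw [hΦ, Real.norm_eq_abs, abs_le]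
    have h6 := Finset.single_le_sum h2 y.2
    rw [h1] at h6
    exact ⟨by linarith, (hB y y.2).trans (le_mul_of_one_le_left h4 hcard)⟩
  calc ‖x‖ ≤ K * ‖Φ x‖ := hlip.le_mul_norm (map_zero Φ) x
    _ ≤ K * (T.card * B) := by gcongr
    _ = K * T.card * B := by ring

lemma SuperlinearJet.exists_mul_norm_sub_le (hEX : SuperlinearJet E f G)
    (hC : ∀ x ∈ E, ∀ y ∈ E, f x ≥ f y + ⟪G y, x - y⟫) (hE : E.Nonempty)
    (hspan : Submodule.span ℝ {w | ∃ x ∈ E, ∃ y ∈ E, w = G x - G y} = ⊤) :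
    ∃ (a : V) (c C : ℝ), 0 < c ∧ ∀ x, c * ‖x‖ - C ≤ tangentEnvelope E f G x - ⟪a, x⟫ := by
  obtain ⟨T, hT, hTE, hsep⟩ := exists_finset_separating_slopes hE hspan
  set a : V := (T.card : ℝ)⁻¹ • ∑ y ∈ T, G y with ha
  have hcard : (T.card : ℝ) ≠ 0 := by exact_mod_cast hT.card_pos.ne'
  obtain ⟨K, hK, hnorm⟩ := exists_norm_le_of_forall_inner_le T hT (fun y => G y - a)
    (by rw [Finset.sum_sub_distrib, Finset.sum_const, ← Nat.cast_smul_eq_nsmul ℝ, ha, smul_smul,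
          mul_inv_cancel₀ hcard, one_smul, sub_self])
    (fun x hx => hsep x fun y hy z hz => by
      have h1 := hx y hy
      have h2 := hx z hz
      rw [inner_sub_left] at h1 h2
      linarith)
  set C := ∑ y ∈ T, |f y - ⟪G y, y⟫|
  refine ⟨a, K⁻¹, C, inv_pos.2 hK, fun x => ?_⟩
  have h1 := hnorm x (tangentEnvelope E f G x - ⟪a, x⟫ + C) fun y hy => by
    have h2 := hEX.le_tangentEnvelope hC x (hTE hy)
    have h3 : |f y - ⟪G y, y⟫| ≤ C :=
      Finset.single_le_sum (f := fun y => |f y - ⟪G y, y⟫|) (fun _ _ => abs_nonneg _) hy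
    have h4 := neg_abs_le (f y - ⟪G y, y⟫)
    rw [inner_sub_right] at h2
    rw [inner_sub_left]
    linarith
  rw [← inv_mul_le_iff₀ hK] at h1
  linarith

end Coercivity

section Extension

variable {V : Type*} [NormedAddCommGroup V] [InnerProductSpace ℝ V]

lemma HasGradientAt.hasSupergradientAt [CompleteSpace V] {g : V → ℝ} {p x : V}
    (hp : HasGradientAt g p x) : HasSupergradientAt g p x := by
  intro ε hε
  have h1 := hp.hasFDerivAt
  rw [hasFDerivAt_iff_isLittleO_nhds_zero, Asymptotics.isLittleO_iff] at h1
  filter_upwards [h1 hε] with h hh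
  rw [InnerProductSpace.toDual_apply_apply, Real.norm_eq_abs, abs_le] at hh
  linarith [hh.2]

lemma HasSupergradientAt.sub_inner {g : V → ℝ} {p x : V} (hp : HasSupergradientAt g p x) (a : V) :
    HasSupergradientAt (fun y => g y - ⟪a, y⟫) (p - a) x := by
  intro ε hε
  filter_upwards [hp ε hε] with h hh
  rw [inner_add_right, inner_sub_left]
  linarith

/-- A function touching `m` from above at `x`, within the square of the distance to a set having
`x` in its closure, inherits the supergradients of `m` at `x`. -/
lemma HasSupergradientAt.of_le_add_infDist_sq {m g : V → ℝ} {p x : V} {E : Set V}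
    (hp : HasSupergradientAt m p x) (hx : x ∈ closure E) (hmg : m x ≤ g x)
    (hgm : ∀ y, g y ≤ m y + Metric.infDist y E ^ 2) : HasSupergradientAt g p x := by
  intro ε hε
  have hsmall : ∀ᶠ h in 𝓝 (0 : V), ‖h‖ < ε / 2 :=
    (continuous_norm.tendsto' (0 : V) 0 norm_zero).eventually_lt_const (half_pos hε)
  filter_upwards [hp (ε / 2) (half_pos hε), hsmall] with h h1 h2
  have h3 : Metric.infDist (x + h) E ≤ ‖h‖ := by
    have := Metric.infDist_le_infDist_add_dist (s := E) (x := x + h) (y := x)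
    rwa [Metric.infDist_zero_of_mem_closure hx, zero_add, dist_self_add_left] at this
  have h4 : Metric.infDist (x + h) E ^ 2 ≤ ‖h‖ ^ 2 :=
    pow_le_pow_left₀ Metric.infDist_nonneg h3 2
  have h5 : ‖h‖ ^ 2 ≤ ε / 2 * ‖h‖ := by
    rw [sq]; gcongr
  linarith [hgm (x + h)]

lemma eq_of_hasGradientAt_of_forall_le [CompleteSpace V] {F : V → ℝ} {p q x : V}
    (hF : HasGradientAt F q x) (hle : ∀ y, F x + ⟪p, y - x⟫ ≤ F y) : q = p := by
  have hd : HasFDerivAt (fun y => F y - InnerProductSpace.toDual ℝ V p y)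
      (InnerProductSpace.toDual ℝ V q - InnerProductSpace.toDual ℝ V p) x :=
    hF.hasFDerivAt.sub (InnerProductSpace.toDual ℝ V p).hasFDerivAt
  have hmin : IsLocalMin (fun y => F y - InnerProductSpace.toDual ℝ V p y) x :=
    Eventually.of_forall fun y => by
      have := hle y
      rw [inner_sub_right] at this
      simp only [InnerProductSpace.toDual_apply_apply]
      linarith
  exact (InnerProductSpace.toDual ℝ V).injective (sub_eq_zero.1 (hmin.hasFDerivAt_eq_zero hd))

/-- A continuous function with supergradients everywhere and growing linearly, up to a linear
function, has a `C¹` convex minorant lying above all of its convex minorants. -/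
lemma exists_convexOn_contDiff_minorant [FiniteDimensional ℝ V] {g : V → ℝ} {a : V} {c C : ℝ}
    (hc : 0 < c) (hgc : Continuous g) (hg : ∀ x, c * ‖x‖ - C ≤ g x - ⟪a, x⟫)
    (hsup : ∀ y, ∃ p, HasSupergradientAt g p y) :
    ∃ F : V → ℝ, ConvexOn ℝ univ F ∧ ContDiff ℝ 1 F ∧ (∀ x, F x ≤ g x) ∧
      ∀ m : V → ℝ, ConvexOn ℝ univ m → (∀ x, m x ≤ g x) → ∀ x, m x ≤ F x := by
  set g₁ : V → ℝ := fun x => g x - ⟪a, x⟫ with hg₁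
  have hlin : ConvexOn ℝ univ fun x => ⟪a, x⟫ := (innerₛₗ ℝ a).convexOn convex_univ
  have hlin' : ConcaveOn ℝ univ fun x => ⟪a, x⟫ := (innerₛₗ ℝ a).concaveOn convex_univ
  have hlow : ∀ x, -C ≤ g₁ x := fun x => by
    have h1 := hg x
    have : 0 ≤ c * ‖x‖ := by positivity
    simp only [hg₁]
    linarith
  have hconv := convexOn_convexEnvelope hlow
  have hgrad : ∀ x, ∃ p, HasGradientAt (convexEnvelope g₁) p x := fun x => by
    obtain ⟨p, hp⟩ := exists_hasSupergradientAt_convexEnvelope hc (by fun_prop) hg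
      (fun y => (hsup y).imp' (· - a) fun p hp => hp.sub_inner a) x
    exact ⟨p, hp.hasGradientAt hconv⟩
  choose p hp using hgrad
  refine ⟨fun x => convexEnvelope g₁ x + ⟪a, x⟫, hconv.add hlin,
    (hconv.contDiff_one_of_hasGradientAt hp).add
      (innerSL ℝ a).contDiff, fun x => ?_, fun m hm hmg x => ?_⟩
  · linarith [convexEnvelope_le_of_mem hlow (mem_convexHull_graph g₁ x)]
  · have := (hm.sub hlin').le_convexEnvelope (g := g₁) (fun y => sub_le_sub_right (hmg y) _) x
    simp only [Pi.sub_apply] at this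
    linarith

theorem SuperlinearJet.exists_convexOn_contDiff_extension [FiniteDimensional ℝ V]
    {E : Set V} {f : V → ℝ} {G : V → V} (hEX : SuperlinearJet E f G) (hE : E.Nonempty)
    (hC : ∀ x ∈ E, ∀ y ∈ E, f x ≥ f y + ⟪G y, x - y⟫)
    (hCW : ∀ x z : ℕ → V, (∀ k, x k ∈ E) → (∀ k, z k ∈ E) →
      (∃ M, ∀ k, ‖x k‖ ≤ M) → (∃ M, ∀ k, ‖G (z k)‖ ≤ M) →
      Tendsto (fun k => f (x k) - f (z k) - ⟪G (z k), x k - z k⟫) atTop (𝓝 0) →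
      Tendsto (fun k => ‖G (x k) - G (z k)‖) atTop (𝓝 0))
    (hspan : Submodule.span ℝ {w | ∃ x ∈ E, ∃ y ∈ E, w = G x - G y} = ⊤) :
    ∃ F : V → ℝ, ConvexOn ℝ univ F ∧ ContDiff ℝ 1 F ∧ (∀ x ∈ E, F x = f x) ∧
      (∀ x ∈ E, gradient F x = G x) ∧ EssentiallyCoercive F := by
  obtain ⟨a, c, C, hc, hcoer⟩ := hEX.exists_mul_norm_sub_le hC hE hspan
  set m := tangentEnvelope E f G with hm
  have hmc : Continuous m := hEX.continuous_tangentEnvelope hC hE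
  obtain ⟨g, hgc, hmg, hgm, hgd⟩ := hmc.exists_majorant_differentiableAt
    ((Metric.continuous_infDist_pt E).pow 2) fun x => sq_nonneg _
  simp only [Pi.pow_apply] at hgm hgd
  have hsup : ∀ x, ∃ p, HasSupergradientAt g p x := by
    intro x
    by_cases hx : x ∈ closure E
    · obtain ⟨p, hp⟩ := hEX.exists_hasSupergradientAt_tangentEnvelope hC hCW hx
      exact ⟨p, hp.of_le_add_infDist_sq hx (hmg x) hgm⟩
    · have hpos : 0 < Metric.infDist x E :=
        lt_of_le_of_ne Metric.infDist_nonneg fun h =>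
          hx ((Metric.mem_closure_iff_infDist_zero hE).2 h.symm)
      exact ⟨_, (hgd x (by positivity)).hasGradientAt.hasSupergradientAt⟩
  obtain ⟨F, hFconv, hFC1, hFg, hFmax⟩ := exists_convexOn_contDiff_minorant hc hgc
    (fun x => (hcoer x).trans (sub_le_sub_right (hmg x) _)) hsup
  have hmF : ∀ x, m x ≤ F x := hFmax m (hEX.convexOn_tangentEnvelope hC hE) hmg
  have hFE : ∀ x ∈ E, F x = f x := by
    intro x hx
    have h1 : m x = f x := hEX.tangentEnvelope_eq hC hx
    have h2 := hgm x
    rw [Metric.infDist_zero_of_mem hx] at h2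
    exact le_antisymm (by linarith [hFg x]) (h1 ▸ hmF x)
  refine ⟨F, hFconv, hFC1, hFE, fun x hx => ?_, innerₛₗ ℝ a, ?_⟩
  · refine eq_of_hasGradientAt_of_forall_le
      ((hFC1.differentiable (by simp)) x).hasGradientAt fun y => ?_
    rw [hFE x hx]
    exact (hEX.le_tangentEnvelope hC y hx).trans (hmF y)
  · have h1 : Tendsto (fun x : V => c * ‖x‖ - C) (comap norm atTop) atTop :=
      tendsto_atTop_add_const_right _ _ (tendsto_comap.const_mul_atTop hc)
    exact tendsto_atTop_mono (fun x => (hcoer x).trans (sub_le_sub_right (hmF x) _)) h1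

end Extension

/-- If a 1-jet `(f, G)` on an arbitrary set `E ⊆ ℝⁿ` satisfies conditions (i)-(iv) of
Corollary 1.3, then it extends to an essentially coercive convex `C¹` function on `ℝⁿ`. -/
theorem c1_convex_extension_essentially_coercive {n : ℕ}
    (E : Set (EuclideanSpace ℝ (Fin n)))
    (f : EuclideanSpace ℝ (Fin n) → ℝ) (G : EuclideanSpace ℝ (Fin n) → EuclideanSpace ℝ (Fin n))
    (hGcont : ContinuousOn G E)
    (hC : ∀ x ∈ E, ∀ y ∈ E, f x ≥ f y + ⟪G y, x - y⟫)
    (hEX : ∀ x : ℕ → EuclideanSpace ℝ (Fin n), (∀ k, x k ∈ E) →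
      Tendsto (fun k => ‖G (x k)‖) atTop atTop →
      Tendsto (fun k => (⟪G (x k), x k⟫ - f (x k)) / ‖G (x k)‖) atTop atTop)
    (hCW : ∀ x z : ℕ → EuclideanSpace ℝ (Fin n), (∀ k, x k ∈ E) → (∀ k, z k ∈ E) →
      (∃ M, ∀ k, ‖x k‖ ≤ M) → (∃ M, ∀ k, ‖G (z k)‖ ≤ M) →
      Tendsto (fun k => f (x k) - f (z k) - ⟪G (z k), x k - z k⟫) atTop (nhds 0) →
      Tendsto (fun k => ‖G (x k) - G (z k)‖) atTop (nhds 0))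
    (hspan : Submodule.span ℝ {w | ∃ x ∈ E, ∃ y ∈ E, w = G x - G y} = ⊤) :
    ∃ F : EuclideanSpace ℝ (Fin n) → ℝ,
      ConvexOn ℝ Set.univ F ∧ ContDiff ℝ 1 F ∧
      (∀ x ∈ E, F x = f x) ∧ (∀ x ∈ E, gradient F x = G x) ∧
      EssentiallyCoercive F := by

  rcases E.eq_empty_or_nonempty with rfl | hE
  · have : Subsingleton (EuclideanSpace ℝ (Fin n)) := by
      rw [← Submodule.subsingleton_iff ℝ, ← subsingleton_iff_bot_eq_top, ← hspan]
      simp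
    refine ⟨fun _ => 0, convexOn_const 0 convex_univ, contDiff_const, by simp, by simp, 0, ?_⟩
    rw [comap_norm_atTop, Bornology.cobounded_eq_bot_iff.2 ⟨Bornology.IsBounded.all _⟩]
    exact tendsto_bot
  · exact (superlinearJet_of_seq hEX).exists_convexOn_contDiff_extension hE hC hCW hspan
end
end

section
/- Let F : ℝⁿ → ℝ be a convex function of class C¹ and let (x_k) be a sequence in ℝⁿ with |∇F(x_k)| → +∞. Then (⟨∇F(x_k), x_k⟩ − F(x_k))/|∇F(x_k)| → +∞. -/
open Filter Topology Set
open scoped RealInnerProductSpace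

noncomputable section

/-- The first-order (supporting hyperplane) inequality for a differentiable convex function. -/
theorem ConvexOn.add_inner_gradient_le {E : Type*} [NormedAddCommGroup E]
    [InnerProductSpace ℝ E] [CompleteSpace E] {F : E → ℝ} (hF : ConvexOn ℝ Set.univ F)
    {x : E} (hd : DifferentiableAt ℝ F x) (y : E) :
    F x + ⟪gradient F x, y - x⟫ ≤ F y := by
  have hconv : ConvexOn ℝ Set.univ (F ∘ AffineMap.lineMap (k := ℝ) x y) := by
    simpa using hF.comp_affineMap (AffineMap.lineMap (k := ℝ) x y)
  have hderiv : HasDerivAt (F ∘ AffineMap.lineMap (k := ℝ) x y) ⟪gradient F x, y - x⟫ 0 := by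
    have hFd : HasFDerivAt F (InnerProductSpace.toDual ℝ E (gradient F x))
        (AffineMap.lineMap (k := ℝ) x y 0) := by
      simpa using hd.hasGradientAt.hasFDerivAt
    simpa using hFd.comp_hasDerivAt (0 : ℝ) AffineMap.hasDerivAt_lineMap
  have hslope := hconv.le_slope_of_hasDerivAt (mem_univ 0) (mem_univ 1) one_pos hderiv
  simp only [slope_def_field, Function.comp_apply, AffineMap.lineMap_apply_one,
    AffineMap.lineMap_apply_zero, sub_zero, div_one] at hslope
  linarith

/-- For a convex `C¹` function `F : ℝⁿ → ℝ` and a sequence `(x k)` with `‖∇F(x k)‖ → ∞`,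
one has `(⟪∇F(x k), x k⟫ - F(x k)) / ‖∇F(x k)‖ → +∞`. -/
theorem gradient_norm_tendsto_atTop {n : ℕ}
    (F : EuclideanSpace ℝ (Fin n) → ℝ)
    (hF : ConvexOn ℝ Set.univ F) (hF1 : ContDiff ℝ 1 F)
    (x : ℕ → EuclideanSpace ℝ (Fin n))
    (hx : Tendsto (fun k => ‖gradient F (x k)‖) atTop atTop) :
    Tendsto (fun k => (⟪gradient F (x k), x k⟫ - F (x k)) / ‖gradient F (x k)‖)
      atTop atTop := by
  refine tendsto_atTop.2 fun b => ?_
  obtain ⟨M, hM⟩ := (isCompact_closedBall (0 : EuclideanSpace ℝ (Fin n)) |b + 1|).bddAbove_image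
    hF1.continuous.continuousOn
  filter_upwards [hx.eventually_ge_atTop M, hx.eventually_gt_atTop 0] with k hMk hpos
  set g := gradient F (x k)
  set y := ((b + 1) / ‖g‖) • g
  have hy : y ∈ Metric.closedBall (0 : EuclideanSpace ℝ (Fin n)) |b + 1| := by
    simp [y, norm_smul, hpos.ne']
  have hFy : F y ≤ M := hM (mem_image_of_mem F hy)
  have hsupp : F (x k) + ⟪g, y - x k⟫ ≤ F y :=
    hF.add_inner_gradient_le (hF1.differentiable one_ne_zero (x k)) y
  have hgy : ⟪g, y⟫ = (b + 1) * ‖g‖ := by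
    rw [real_inner_smul_right, real_inner_self_eq_norm_sq]
    field_simp
  rw [inner_sub_right, hgy] at hsupp
  rw [le_div_iff₀ hpos]
  linarith
end
end

section
/- Let E be a subset of ℝⁿ and f : E → ℝ, G : E → ℝⁿ functions such that: (i) f(x) ≥ f(y) + ⟨G(y), x − y⟩ for all x, y ∈ E; and (ii) for every sequence (x_k) in E with |G(x_k)| → +∞ one has (⟨G(x_k), x_k⟩ − f(x_k))/|G(x_k)| → +∞. Define m(x) = sup_{y ∈ E} { f(y) + ⟨G(y), x − y⟩ } for x ∈ ℝⁿ. Then m(x) < +∞ for every x ∈ ℝⁿ, m is convex, m = f on E, and for every x ∈ E the vector G(x) belongs to the subdifferential ∂m(x), i.e. m(y) ≥ m(x) + ⟨G(x), y − x⟩ for all y ∈ ℝⁿ. -/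
open Filter Topology Set
open scoped RealInnerProductSpace

noncomputable section

/-- The affine minorants of a convex 1-jet are bounded above at every point, provided
`(⟪G, x⟫ - f) / ‖G‖` tends to infinity along every sequence on which `‖G‖` does. -/
theorem bddAbove_affine_minorants {V : Type*} [NormedAddCommGroup V]
    [InnerProductSpace ℝ V] {E : Set V} {f : V → ℝ} {G : V → V}
    (hC : ∀ x ∈ E, ∀ y ∈ E, f x ≥ f y + ⟪G y, x - y⟫)
    (hEX : ∀ x : ℕ → V, (∀ k, x k ∈ E) →
      Tendsto (fun k => ‖G (x k)‖) atTop atTop →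
      Tendsto (fun k => (⟪G (x k), x k⟫ - f (x k)) / ‖G (x k)‖) atTop atTop) (x : V) :
    BddAbove {t | ∃ y ∈ E, t = f y + ⟪G y, x - y⟫} := by
  by_contra hb
  have unbounded : ∀ k : ℕ, ∃ y ∈ E, (k : ℝ) < f y + ⟪G y, x - y⟫ := by
    intro k
    obtain ⟨_, ⟨y, hy, rfl⟩, hk⟩ := not_bddAbove_iff.1 hb k
    exact ⟨y, hy, hk⟩
  choose y hyE hy using unbounded
  set c := ‖x - y 0‖ + 1 with hc
  have c_pos : 0 < c := by positivity
  have norm_G_lower (k : ℕ) : ((k : ℝ) - f (y 0)) / c ≤ ‖G (y k)‖ := by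
    rw [div_le_iff₀ c_pos]
    have hcs := real_inner_le_norm (G (y k)) (x - y 0)
    have hsplit : ⟪G (y k), x - y k⟫ = ⟪G (y k), x - y 0⟫ + ⟪G (y k), y 0 - y k⟫ := by
      rw [← inner_add_right, sub_add_sub_cancel]
    have hjet := hC (y 0) (hyE 0) (y k) (hyE k)
    nlinarith [hy k, norm_nonneg (G (y k))]
  have norm_G_tendsto : Tendsto (fun k => ‖G (y k)‖) atTop atTop :=
    tendsto_atTop_mono norm_G_lower
      ((tendsto_atTop_add_const_right atTop (-f (y 0))
        tendsto_natCast_atTop_atTop).atTop_div_const c_pos)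
  obtain ⟨k, hratio, hpos⟩ := (((hEX y hyE norm_G_tendsto).eventually_ge_atTop ‖x‖).and
    (norm_G_tendsto.eventually_gt_atTop 0)).exists
  rw [le_div_iff₀ hpos] at hratio
  have hcs := real_inner_le_norm (G (y k)) x
  have hk := hy k
  rw [inner_sub_right] at hk
  linarith [Nat.cast_nonneg (α := ℝ) k, mul_comm ‖x‖ ‖G (y k)‖]

/-- **Lemma 4.3.** Under conditions (i) and (ii), the minimal convex extension
`m(x) = sup_{y ∈ E} (f(y) + ⟪G(y), x - y⟫)` is finite everywhere (the sets are bounded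
above), convex, coincides with `f` on `E`, and `G(x) ∈ ∂m(x)` for every `x ∈ E`. -/
theorem minimal_convex_extension_finite {n : ℕ}
    (E : Set (EuclideanSpace ℝ (Fin n)))
    (f : EuclideanSpace ℝ (Fin n) → ℝ) (G : EuclideanSpace ℝ (Fin n) → EuclideanSpace ℝ (Fin n))
    (hC : ∀ x ∈ E, ∀ y ∈ E, f x ≥ f y + ⟪G y, x - y⟫)
    (hEX : ∀ x : ℕ → EuclideanSpace ℝ (Fin n), (∀ k, x k ∈ E) →
      Tendsto (fun k => ‖G (x k)‖) atTop atTop →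
      Tendsto (fun k => (⟪G (x k), x k⟫ - f (x k)) / ‖G (x k)‖) atTop atTop)
    (m : EuclideanSpace ℝ (Fin n) → ℝ)
    (hm : ∀ x, m x = sSup {t | ∃ y ∈ E, t = f y + ⟪G y, x - y⟫}) :
    (∀ x, BddAbove {t | ∃ y ∈ E, t = f y + ⟪G y, x - y⟫}) ∧
    ConvexOn ℝ Set.univ m ∧
    (∀ x ∈ E, m x = f x) ∧
    (∀ x ∈ E, ∀ y, m y ≥ m x + ⟪G x, y - x⟫) := by
  have hb := bddAbove_affine_minorants hC hEX
  have le_m : ∀ x, ∀ y ∈ E, f y + ⟪G y, x - y⟫ ≤ m x := fun x y hy => by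
    rw [hm]
    exact le_csSup (hb x) ⟨y, hy, rfl⟩
  have m_le : E.Nonempty → ∀ x c, (∀ y ∈ E, f y + ⟪G y, x - y⟫ ≤ c) → m x ≤ c := by
    rintro ⟨y, hy⟩ x c h
    rw [hm]
    refine csSup_le ⟨_, y, hy, rfl⟩ ?_
    rintro _ ⟨z, hz, rfl⟩
    exact h z hz
  have m_eq : ∀ x ∈ E, m x = f x := fun x hx =>
    le_antisymm (m_le ⟨x, hx⟩ x _ fun y hy => hC x hx y hy) (by simpa using le_m x x hx)
  refine ⟨hb, ⟨convex_univ, ?_⟩, m_eq, fun x hx y => m_eq x hx ▸ le_m y x hx⟩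
  intro x _ z _ a b ha hb hab
  rcases E.eq_empty_or_nonempty with rfl | hE
  · simp [hm]
  refine m_le hE _ _ fun y hy => ?_
  have hx := mul_le_mul_of_nonneg_left (le_m x y hy) ha
  have hz := mul_le_mul_of_nonneg_left (le_m z y hy) hb
  simp only [inner_sub_right, inner_add_right, real_inner_smul_right, smul_eq_mul] at hx hz ⊢
  obtain rfl : b = 1 - a := by linarith
  linarith
end
end

section
/- A convex function f : ℝⁿ → ℝ is essentially coercive if and only if f is supported at some point by an (n+1)-dimensional corner function; that is, if and only if there exist linear functions ℓ_1, …, ℓ_{n+1} : ℝⁿ → ℝ with {ℓ_2 − ℓ_1, …, ℓ_{n+1} − ℓ_1} linearly independent in the dual of ℝⁿ, numbers b_1, …, b_{n+1} ∈ ℝ, and a point x_0 ∈ ℝⁿ, such that C(x) := max_{1 ≤ j ≤ n+1}(ℓ_j(x) + b_j) satisfies C ≤ f on ℝⁿ and C(x_0) = f(x_0). -/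
open Filter Topology Set
open scoped RealInnerProductSpace

noncomputable section

/-- A convex function that exceeds its value at `x₀` by at least `1` on the sphere of
radius `R` about `x₀` grows at least linearly outside that sphere. -/
lemma ConvexOn.add_norm_sub_div_le_of_sphere {V : Type*} [NormedAddCommGroup V]
    [NormedSpace ℝ V] {g : V → ℝ} (hg : ConvexOn ℝ univ g) {x₀ : V} {R : ℝ} (hR : 0 < R)
    (hsphere : ∀ y, ‖y - x₀‖ = R → g x₀ + 1 ≤ g y) {x : V} (hx : R ≤ ‖x - x₀‖) :
    g x₀ + ‖x - x₀‖ / R ≤ g x := by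
  set d := ‖x - x₀‖ with hd
  have hd0 : 0 < d := hR.trans_le hx
  have ht1 : R / d ≤ 1 := (div_le_one hd0).2 hx
  have ht0 : 0 < R / d := div_pos hR hd0
  have hconv := hg.2 (mem_univ x₀) (mem_univ x) (sub_nonneg.2 ht1) ht0.le (by ring)
  have hy := hsphere ((1 - R / d) • x₀ + (R / d) • x) (by
    have : (1 - R / d) • x₀ + (R / d) • x - x₀ = (R / d) • (x - x₀) := by module
    rw [this, norm_smul, Real.norm_of_nonneg ht0.le, ← hd]
    field_simp)
  simp only [smul_eq_mul] at hconv
  have hmul : 1 ≤ R / d * (g x - g x₀) := by linarith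
  have : d / R ≤ g x - g x₀ := by
    rw [div_le_iff₀ hR]
    rw [div_mul_eq_mul_div, le_div_iff₀ hd0] at hmul
    linarith
  linarith

/-- If a convex function tends to `+∞` at infinity, it attains its minimum, and it lies above
every affine function of sufficiently small slope through a point one below the minimum. -/
lemma ConvexOn.exists_affine_le_of_tendsto_cobounded {V : Type*} [NormedAddCommGroup V]
    [NormedSpace ℝ V] [FiniteDimensional ℝ V] {g : V → ℝ} (hg : ConvexOn ℝ univ g)
    (hlim : Tendsto g (comap norm atTop) atTop) :
    ∃ (x₀ : V) (ε : ℝ), 0 < ε ∧ (∀ x, g x₀ ≤ g x) ∧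
      ∀ (x : V) (a : ℝ), a ≤ ‖x - x₀‖ → ε * a + (g x₀ - 1) ≤ g x := by
  rw [comap_norm_atTop] at hlim
  have hcont : Continuous g := continuousOn_univ.1 (hg.continuousOn isOpen_univ)
  obtain ⟨x₀, hx₀⟩ := hcont.exists_forall_le
    (by have := FiniteDimensional.proper ℝ V; rwa [← Metric.cobounded_eq_cocompact])
  obtain ⟨r, -, hr⟩ := ((Metric.hasBasis_cobounded_compl_closedBall x₀).eventually_iff).1
    (hlim.eventually_ge_atTop (g x₀ + 1))
  set R := max r 0 + 1
  have hR : 0 < R := by positivity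
  have hrR : r < R := lt_of_le_of_lt (le_max_left r 0) (lt_add_one _)
  refine ⟨x₀, R⁻¹, inv_pos.2 hR, hx₀, fun x a ha => ?_⟩
  have hle : R⁻¹ * a ≤ ‖x - x₀‖ / R := by
    rw [div_eq_inv_mul]; gcongr
  rcases le_total R ‖x - x₀‖ with h | h
  · have := hg.add_norm_sub_div_le_of_sphere hR
      (fun y hy => hr (by simp [dist_eq_norm, hy, hrR])) h
    linarith
  · have := (div_le_one hR).2 h
    linarith [hx₀ x]

/-- If the differences of `n + 1` linear forms separate points, then their
maximum minus their average is bounded below by a multiple of the norm. -/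
lemma exists_norm_le_mul_of_forall_sub_average_le {V : Type*} [NormedAddCommGroup V]
    [NormedSpace ℝ V] [FiniteDimensional ℝ V] {n : ℕ} (ℓ : Fin (n + 1) → V →ₗ[ℝ] ℝ)
    (hℓ : ∀ x, (∀ j : Fin n, (ℓ j.succ - ℓ 0) x = 0) → x = 0) :
    ∃ K : ℝ, 0 < K ∧ ∀ (x : V) (M : ℝ),
      (∀ j, ℓ j x - ((n + 1 : ℝ)⁻¹ • ∑ i, ℓ i) x ≤ M) → ‖x‖ ≤ K * M := by
  set L : V →ₗ[ℝ] (Fin n → ℝ) := LinearMap.pi fun j => ℓ j.succ - ℓ 0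
  have hL : LinearMap.ker L = ⊥ := by
    refine LinearMap.ker_eq_bot'.2 fun x hx => hℓ x fun j => ?_
    exact congrFun hx j
  obtain ⟨K, hK, hanti⟩ := L.exists_antilipschitzWith hL
  have hn : (0 : ℝ) < n + 1 := by positivity
  refine ⟨K * (n + 1), by positivity, fun x M hM => ?_⟩
  set ℓ' : V →ₗ[ℝ] ℝ := (n + 1 : ℝ)⁻¹ • ∑ i, ℓ i with hℓ'
  have hsum : ∑ i, (ℓ i x - ℓ' x) = 0 := by
    simp only [Finset.sum_sub_distrib, Finset.sum_const, Finset.card_univ, Fintype.card_fin,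
      hℓ', LinearMap.smul_apply, LinearMap.sum_apply, nsmul_eq_mul, smul_eq_mul]
    push_cast
    field_simp
    ring
  have hlow : ∀ j, -(n * M) ≤ ℓ j x - ℓ' x := by
    intro j
    have h := Finset.sum_le_card_nsmul (Finset.univ.erase j) (fun i => ℓ i x - ℓ' x) M
      fun i _ => hM i
    rw [← Finset.add_sum_erase _ _ (Finset.mem_univ j)] at hsum
    simp only [Finset.mem_univ, Finset.card_erase_of_mem, Finset.card_univ, Fintype.card_fin,
      add_tsub_cancel_right, nsmul_eq_mul] at h
    linarith
  have hM0 : 0 ≤ M := by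
    have h1 := hlow 0
    have h2 := hM 0
    have : 0 ≤ (n + 1) * M := by linarith
    exact nonneg_of_mul_nonneg_right this hn
  have hLx : ‖L x‖ ≤ (n + 1) * M := by
    refine (pi_norm_le_iff_of_nonneg (by positivity)).2 fun j => ?_
    have : L x j = ℓ j.succ x - ℓ 0 x := rfl
    rw [this, Real.norm_eq_abs, abs_le]
    constructor <;> linarith [hlow 0, hM 0, hlow j.succ, hM j.succ]
  calc ‖x‖ ≤ K * ‖L x‖ := by simpa using hanti.le_mul_dist x 0
    _ ≤ K * ((n + 1) * M) := by gcongr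
    _ = K * (n + 1) * M := by ring

/-- Linear forms spanning the dual separate points: `n` linearly independent linear forms on an
`n`-dimensional space have no common nonzero zero. -/
lemma LinearIndependent.eq_zero_of_forall_apply_eq_zero {V : Type*} [AddCommGroup V]
    [Module ℝ V] [FiniteDimensional ℝ V] {n : ℕ} (hn : Module.finrank ℝ V = n)
    {φ : Fin n → Module.Dual ℝ V} (hφ : LinearIndependent ℝ φ) {x : V}
    (hx : ∀ j, φ j x = 0) : x = 0 := by
  have hspan : Submodule.span ℝ (range φ) = ⊤ :=
    hφ.span_eq_top_of_card_eq_finrank' (by simp [Subspace.dual_finrank_eq, hn])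
  refine (Module.forall_dual_apply_eq_zero_iff ℝ x).1 fun ψ => ?_
  have hψ : ψ ∈ Submodule.span ℝ (range φ) := hspan ▸ Submodule.mem_top
  induction hψ using Submodule.span_induction with
  | mem ψ h => obtain ⟨j, rfl⟩ := h; exact hx j
  | zero => rfl
  | add _ _ _ _ h₁ h₂ => simp [h₁, h₂]
  | smul _ _ _ h => simp [h]

/-- A function bounded below by a corner function of full dimension is essentially coercive. -/
lemma EssentiallyCoercive.of_corner_le {V : Type*} [NormedAddCommGroup V] [NormedSpace ℝ V]
    [FiniteDimensional ℝ V] {n : ℕ} (hn : Module.finrank ℝ V = n) {f : V → ℝ}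
    (ℓ : Fin (n + 1) → V →ₗ[ℝ] ℝ) (b : Fin (n + 1) → ℝ)
    (hℓ : LinearIndependent ℝ fun j : Fin n => ℓ j.succ - ℓ 0)
    (hle : ∀ x j, ℓ j x + b j ≤ f x) : EssentiallyCoercive f := by
  obtain ⟨K, hK, hbound⟩ := exists_norm_le_mul_of_forall_sub_average_le ℓ
    fun x hx => hℓ.eq_zero_of_forall_apply_eq_zero hn hx
  obtain ⟨B, hB⟩ := (finite_range b).bddBelow
  refine ⟨(n + 1 : ℝ)⁻¹ • ∑ i, ℓ i, ?_⟩
  have hlim : Tendsto (fun x : V => K⁻¹ * ‖x‖ + B) (comap norm atTop) atTop :=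
    tendsto_atTop_add_const_right _ _ (tendsto_comap.const_mul_atTop (inv_pos.2 hK))
  refine tendsto_atTop_mono (fun x => ?_) hlim
  have h := hbound x (f x - ((n + 1 : ℝ)⁻¹ • ∑ i, ℓ i) x - B) fun j => by
    linarith [hle x j, hB (mem_range_self j)]
  rw [← inv_mul_le_iff₀ hK] at h
  linarith

/-- A convex function `f : ℝⁿ → ℝ` is essentially coercive if and only if it is supported at
some point by an `(n+1)`-dimensional corner function
`C(x) = max_{1 ≤ j ≤ n+1} (ℓ_j(x) + b_j)`, where `{ℓ_2 - ℓ_1, …, ℓ_{n+1} - ℓ_1}` are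
linearly independent linear forms. -/
theorem essentiallyCoercive_iff_supported_by_corner {n : ℕ}
    (f : EuclideanSpace ℝ (Fin n) → ℝ) (hf : ConvexOn ℝ Set.univ f) :
    EssentiallyCoercive f ↔
      ∃ (ℓ : Fin (n + 1) → (EuclideanSpace ℝ (Fin n) →ₗ[ℝ] ℝ)) (b : Fin (n + 1) → ℝ)
        (x₀ : EuclideanSpace ℝ (Fin n)),
        LinearIndependent ℝ (fun j : Fin n => ℓ j.succ - ℓ 0) ∧
        (∀ x, (⨆ j : Fin (n + 1), (ℓ j x + b j)) ≤ f x) ∧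
        (⨆ j : Fin (n + 1), (ℓ j x₀ + b j)) = f x₀ := by
  constructor
  · rintro ⟨ℓ, hℓ⟩
    have hg : ConvexOn ℝ univ fun x => f x - ℓ x := hf.sub (ℓ.concaveOn convex_univ)
    obtain ⟨x₀, ε, hε, hmin, haff⟩ := hg.exists_affine_le_of_tendsto_cobounded hℓ
    set e : Fin n → (EuclideanSpace ℝ (Fin n) →ₗ[ℝ] ℝ) :=
      (EuclideanSpace.basisFun (Fin n) ℝ).toBasis.coord with he
    have he_apply : ∀ j x, e j x = x j := fun j x => by simp [he]
    set p : Fin (n + 1) → (EuclideanSpace ℝ (Fin n) →ₗ[ℝ] ℝ) :=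
      Fin.cons ℓ fun j => ℓ + ε • e j with hp
    set b : Fin (n + 1) → ℝ :=
      Fin.cons (f x₀ - ℓ x₀) fun j => f x₀ - ℓ x₀ - 1 - ε * x₀ j with hb
    have hle : ∀ x, (⨆ j : Fin (n + 1), (p j x + b j)) ≤ f x := fun x => by
      refine ciSup_le fun j => ?_
      refine Fin.cases ?_ (fun j => ?_) j
      · simp only [hp, hb, Fin.cons_zero]
        linarith [hmin x]
      · have h := haff x (x j - x₀ j) ((le_abs_self _).trans (by
          simpa using PiLp.norm_apply_le (x - x₀) j))
        simp only [hp, hb, Fin.cons_succ, LinearMap.add_apply, LinearMap.smul_apply, he_apply,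
          smul_eq_mul]
        linarith
    refine ⟨p, b, x₀, ?_, hle, (hle x₀).antisymm ?_⟩
    · have hdiff : (fun j : Fin n => p j.succ - p 0) = fun j => Units.mk0 ε hε.ne' • e j := by
        ext1 j
        simp [hp, Units.smul_def]
      rw [hdiff]
      exact ((EuclideanSpace.basisFun (Fin n) ℝ).toBasis.linearIndependent_coord).units_smul _
    · refine le_ciSup_of_le (finite_range _).bddAbove 0 ?_
      simp [hp, hb]
  · rintro ⟨ℓ, b, x₀, hℓ, hle, -⟩
    exact .of_corner_le finrank_euclideanSpace_fin ℓ b hℓ fun x j =>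
      (le_ciSup (f := fun j => ℓ j x + b j) (finite_range _).bddAbove j).trans (hle x)
end
end
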